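/- There exists a constant C such that for every real X ≥ 1 and every squarefree natural number d ≤ X, the quantity |#{n ≤ X : n squarefree and d ∣ n} − #{n ≤ X : n squarefree}/σ(d)| is at most C·X^{3/4}, where σ(d) is the sum of the positive divisors of d. -/

import Mathlib

open ArithmeticFunction.Moebius in
theorem sum_divisors_moebius (n : ℕ) : ∑ k ∈ n.divisors, μ k = if n = 1 then 1 else 0 := by
  rw [← ArithmeticFunction.coe_mul_zeta_apply, ArithmeticFunction.moebius_mul_coe_zeta,
    ArithmeticFunction.one_apply]

theorem Nat.sq_dvd_sq_mul_squarefree_iff {a b k : ℕ} (ha : Squarefree a) :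
    k ^ 2 ∣ b ^ 2 * a ↔ k ∣ b := by
  refine ⟨fun h => ?_, fun h => Dvd.dvd.mul_right (pow_dvd_pow_of_dvd h 2) a⟩
  rcases Nat.eq_zero_or_pos b with rfl | hb
  · exact dvd_zero k
  obtain ⟨g, k', b', hg, hco, rfl, rfl⟩ := Nat.exists_coprime' (m := k) (n := b)
    (Nat.gcd_pos_of_pos_right k hb)
  have h' : k' ^ 2 ∣ b' ^ 2 * a := by
    have : g ^ 2 * k' ^ 2 ∣ g ^ 2 * (b' ^ 2 * a) := by
      convert h using 1 <;> ring
    exact Nat.dvd_of_mul_dvd_mul_left (by positivity) this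
  have h1 : k' ^ 2 ∣ a := (Nat.Coprime.pow 2 2 hco).dvd_of_dvd_mul_left h'
  have h2 : k' = 1 := Nat.isUnit_iff.mp (ha k' (by rwa [← sq]))
  simp [h2]

open ArithmeticFunction.Moebius in
theorem sum_moebius_sq_dvd {n N : ℕ} (hn : 0 < n) (hN : n ≤ N) :
    ∑ k ∈ Finset.Ioc 0 N with k ^ 2 ∣ n, μ k = if Squarefree n then 1 else 0 := by
  obtain ⟨a, b, rfl, ha⟩ := Nat.sq_mul_squarefree n
  have hb : 0 < b := Nat.pos_of_ne_zero (by rintro rfl; simp at hn)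
  have hset : (Finset.Ioc 0 N).filter (fun k => k ^ 2 ∣ b ^ 2 * a) = b.divisors := by
    ext k
    simp only [Finset.mem_filter, Finset.mem_Ioc, Nat.mem_divisors,
      Nat.sq_dvd_sq_mul_squarefree_iff ha]
    refine ⟨fun h => ⟨h.2, hb.ne'⟩, fun h => ⟨⟨Nat.pos_of_dvd_of_pos h.1 hb, ?_⟩, h.1⟩⟩
    have := Nat.le_of_dvd hn (((dvd_pow_self k two_ne_zero).trans
      (pow_dvd_pow_of_dvd h.1 2)).mul_right a)
    omega
  rw [hset, sum_divisors_moebius]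
  refine if_congr ⟨fun h => by simpa [h] using ha, fun h => ?_⟩ rfl rfl
  exact Nat.isUnit_iff.mp (h b ⟨a, by ring⟩)

open ArithmeticFunction.Moebius in
theorem sum_moebius_dvd_gcd {d : ℕ} (hd : d ≠ 0) (n : ℕ) :
    ∑ g ∈ d.divisors with g ∣ n, μ g = if n.Coprime d then 1 else 0 := by
  have hset : d.divisors.filter (fun g => g ∣ n) = (n.gcd d).divisors := by
    ext g
    simp [Nat.dvd_gcd_iff, hd, and_comm]
  rw [hset, sum_divisors_moebius]

/-- The number of squarefree `1 ≤ m ≤ N` that are coprime to `d`. -/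
def squarefreeCoprimeCount (d N : ℕ) : ℕ :=
  ((Finset.Ioc 0 N).filter (fun m => Squarefree m ∧ m.Coprime d)).card

open ArithmeticFunction.Moebius in
theorem squarefreeCoprimeCount_eq_sum {d M N : ℕ} (hd : d ≠ 0) (hMN : M ≤ N) :
    (squarefreeCoprimeCount d M : ℤ) = ∑ g ∈ d.divisors, ∑ k ∈ Finset.Ioc 0 N,
      μ g * μ k * ((M / Nat.lcm g (k ^ 2) : ℕ) : ℤ) := by
  have h1 : ∀ n ∈ Finset.Ioc 0 M, (if Squarefree n ∧ n.Coprime d then (1 : ℤ) else 0) =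
      ∑ g ∈ d.divisors, ∑ k ∈ Finset.Ioc 0 N,
        if Nat.lcm g (k ^ 2) ∣ n then μ g * μ k else 0 := by
    intro n hn
    rw [Finset.mem_Ioc] at hn
    have hmul : (if Squarefree n ∧ n.Coprime d then (1 : ℤ) else 0) =
        (if n.Coprime d then 1 else 0) * (if Squarefree n then 1 else 0) := by
      split_ifs <;> simp_all
    rw [hmul, ← sum_moebius_dvd_gcd hd, ← sum_moebius_sq_dvd hn.1 (hn.2.trans hMN),
      Finset.sum_filter, Finset.sum_filter, Finset.sum_mul_sum]
    refine Finset.sum_congr rfl fun g _ => Finset.sum_congr rfl fun k _ => ?_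
    simp only [Nat.lcm_dvd_iff]
    split_ifs <;> simp_all
  rw [squarefreeCoprimeCount, Finset.card_filter]
  push_cast
  rw [Finset.sum_congr rfl h1, Finset.sum_comm]
  refine Finset.sum_congr rfl fun g _ => ?_
  rw [Finset.sum_comm]
  refine Finset.sum_congr rfl fun k _ => ?_
  rw [← Finset.sum_filter, Finset.sum_const, Nat.Ioc_filter_dvd_card_eq_div, nsmul_eq_mul,
    mul_comm, Int.natCast_ediv]

theorem sum_min_one_div_sq_le {a : ℝ} (ha : 0 < a) (N : ℕ) :
    ∑ k ∈ Finset.Ioc 0 N, min 1 (a ^ 2 / (k : ℝ) ^ 2) ≤ 4 * a := by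
  suffices h : ∑ k ∈ Finset.Ioc 0 N, min 1 (a ^ 2 / (k : ℝ) ^ 2) ≤ 4 * a * (N / (a + N)) by
    refine h.trans (mul_le_of_le_one_right (by positivity) ?_)
    rw [div_le_one (by positivity)]
    linarith
  induction N with
  | zero => simp
  | succ N ih =>
    rw [Finset.sum_Ioc_succ_top (Nat.zero_le N)]
    have hstep : min 1 (a ^ 2 / ((N + 1 : ℕ) : ℝ) ^ 2) ≤
        4 * a * ((N + 1 : ℕ) / (a + (N + 1 : ℕ))) - 4 * a * (N / (a + N)) := by
      push_cast
      have hN : (0 : ℝ) ≤ N := N.cast_nonneg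
      have hdiff : 4 * a * (((N : ℝ) + 1) / (a + (N + 1))) - 4 * a * (N / (a + N)) =
          4 * a ^ 2 / ((a + (N + 1)) * (a + N)) := by
        field_simp
        ring
      rw [hdiff]
      have hle : 4 * a ^ 2 / (a + (N + 1)) ^ 2 ≤ 4 * a ^ 2 / ((a + (N + 1)) * (a + N)) := by
        apply div_le_div_of_nonneg_left (by positivity) (by positivity)
        nlinarith
      refine le_trans ?_ hle
      rcases le_total a (N + 1 : ℝ) with h | h
      · refine (min_le_right _ _).trans ?_
        rw [div_le_div_iff₀ (by positivity) (by positivity)]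
        have : (a + (N + 1)) ^ 2 ≤ 4 * ((N : ℝ) + 1) ^ 2 := by nlinarith
        nlinarith [mul_le_mul_of_nonneg_left this (sq_nonneg a)]
      · refine (min_le_left _ _).trans ?_
        rw [le_div_iff₀ (by positivity)]
        nlinarith
    linarith

theorem abs_floor_sub_self_le_min {y : ℝ} (hy : 0 ≤ y) : |(⌊y⌋₊ : ℝ) - y| ≤ min 1 y := by
  have h1 := Nat.floor_le hy
  have h2 := Nat.lt_floor_add_one y
  have h3 : (0 : ℝ) ≤ ⌊y⌋₊ := Nat.cast_nonneg _
  rw [abs_sub_comm, abs_of_nonneg (by linarith)]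
  exact le_min (by linarith) (by linarith)

open ArithmeticFunction.Moebius in
theorem exists_abs_squarefreeCoprimeCount_sub_le {d : ℕ} (hd : d ≠ 0) (N : ℕ) :
    ∃ c : ℝ, ∀ y : ℝ, 0 < y → ⌊y⌋₊ ≤ N →
      |(squarefreeCoprimeCount d ⌊y⌋₊ : ℝ) - c * y| ≤ 4 * d.divisors.card * √y := by
  refine ⟨∑ g ∈ d.divisors, ∑ k ∈ Finset.Ioc 0 N,
    (μ g : ℝ) * μ k * (1 / (Nat.lcm g (k ^ 2) : ℕ)), fun y hy hyN => ?_⟩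
  have hcount : (squarefreeCoprimeCount d ⌊y⌋₊ : ℝ) = ∑ g ∈ d.divisors, ∑ k ∈ Finset.Ioc 0 N,
      (μ g : ℝ) * μ k * ((⌊y⌋₊ / Nat.lcm g (k ^ 2) : ℕ) : ℝ) := by
    have h := congrArg (Int.cast : ℤ → ℝ) (squarefreeCoprimeCount_eq_sum hd hyN)
    simpa only [Int.cast_natCast, Int.cast_sum, Int.cast_mul] using h
  have hterm : ∀ g ∈ d.divisors, ∀ k ∈ Finset.Ioc 0 N,
      |(μ g : ℝ) * μ k * ((⌊y⌋₊ / Nat.lcm g (k ^ 2) : ℕ) : ℝ) -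
        (μ g : ℝ) * μ k * (1 / (Nat.lcm g (k ^ 2) : ℕ)) * y| ≤
      min 1 (√y ^ 2 / (k : ℝ) ^ 2) := by
    intro g hg k hk
    have hk0 : 0 < k := (Finset.mem_Ioc.mp hk).1
    have hg0 : 0 < g := Nat.pos_of_mem_divisors hg
    have hlcm : k ^ 2 ≤ Nat.lcm g (k ^ 2) :=
      Nat.le_of_dvd (Nat.lcm_pos hg0 (by positivity)) (Nat.dvd_lcm_right _ _)
    have hlcm' : (k : ℝ) ^ 2 ≤ (Nat.lcm g (k ^ 2) : ℕ) := by exact_mod_cast hlcm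
    have hμ : ∀ n : ℕ, |(μ n : ℝ)| ≤ 1 := fun n => by
      exact_mod_cast ArithmeticFunction.abs_moebius_le_one (n := n)
    rw [← Nat.floor_div_natCast, mul_assoc _ _ y, ← mul_sub, abs_mul, abs_mul,
      one_div_mul_eq_div, Real.sq_sqrt hy.le]
    calc _ ≤ 1 * |(⌊y / (Nat.lcm g (k ^ 2) : ℕ)⌋₊ : ℝ) - y / (Nat.lcm g (k ^ 2) : ℕ)| := by
          gcongr
          exact mul_le_one₀ (hμ g) (abs_nonneg _) (hμ k)
      _ ≤ min 1 (y / (Nat.lcm g (k ^ 2) : ℕ)) := by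
          rw [one_mul]
          exact abs_floor_sub_self_le_min (by positivity)
      _ ≤ _ := by
          gcongr
  rw [hcount, Finset.sum_mul, ← Finset.sum_sub_distrib]
  calc _ ≤ ∑ g ∈ d.divisors, 4 * √y := by
        refine (Finset.abs_sum_le_sum_abs _ _).trans (Finset.sum_le_sum fun g hg => ?_)
        rw [Finset.sum_mul, ← Finset.sum_sub_distrib]
        exact (Finset.abs_sum_le_sum_abs _ _).trans
          ((Finset.sum_le_sum (hterm g hg)).trans (sum_min_one_div_sq_le (Real.sqrt_pos.2 hy) N))
    _ = _ := by
        rw [Finset.sum_const, nsmul_eq_mul]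
        ring

theorem Nat.card_divisors_le_two_mul_sqrt (d : ℕ) : d.divisors.card ≤ 2 * Nat.sqrt d := by
  rw [← Finset.card_filter_add_card_filter_not (s := d.divisors) (fun e => e ≤ Nat.sqrt d), two_mul]
  have hcard : (Finset.Ioc 0 (Nat.sqrt d)).card = Nat.sqrt d := by simp
  refine add_le_add ((Finset.card_le_card fun e he => ?_).trans_eq hcard)
    ((Finset.card_le_card_of_injOn (fun e => d / e) (fun e he => ?_)
      fun e he f hf h => ?_).trans_eq hcard)
  · rw [Finset.mem_filter] at he
    exact Finset.mem_Ioc.mpr ⟨Nat.pos_of_mem_divisors he.1, he.2⟩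
  · rw [Finset.mem_coe, Finset.mem_filter, not_le] at he
    rw [Finset.mem_coe, Finset.mem_Ioc]
    refine ⟨Nat.div_pos (Nat.divisor_le he.1) (Nat.pos_of_mem_divisors he.1), ?_⟩
    have h1 := Nat.lt_succ_sqrt d
    rw [← Nat.lt_succ_iff, Nat.div_lt_iff_lt_mul (Nat.pos_of_mem_divisors he.1)]
    exact h1.trans_le (Nat.mul_le_mul_left _ he.2)
  · rw [Finset.mem_coe, Finset.mem_filter, Nat.mem_divisors] at he hf
    rw [← Nat.div_div_self he.1.1 he.1.2, ← Nat.div_div_self hf.1.1 hf.1.2]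
    exact congrArg (d / ·) h

theorem card_squarefree_gcd_eq {d g : ℕ} (hd : Squarefree d) (hg : g ∣ d) (N : ℕ) :
    ((Finset.Ioc 0 N).filter (fun n => Squarefree n ∧ n.gcd d = g)).card =
      squarefreeCoprimeCount d (N / g) := by
  obtain ⟨e, rfl⟩ := hg
  have hg0 : 0 < g := Nat.pos_of_ne_zero (by rintro rfl; simp at hd)
  have hge := Nat.squarefree_mul_iff.mp hd
  symm
  refine Finset.card_bij (fun m _ => g * m) (fun m hm => ?_)
    (fun m _ m' _ h => Nat.eq_of_mul_eq_mul_left hg0 h) fun n hn => ?_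
  · simp only [Finset.mem_filter, Finset.mem_Ioc, Nat.coprime_mul_iff_right] at hm ⊢
    obtain ⟨⟨hm0, hmN⟩, hsq, hmg, hme⟩ := hm
    refine ⟨⟨by positivity, ?_⟩, Nat.squarefree_mul_iff.mpr ⟨hmg.symm, hge.2.1, hsq⟩, ?_⟩
    · rw [mul_comm]
      exact (Nat.le_div_iff_mul_le hg0).mp hmN
    · rw [Nat.gcd_mul_left, Nat.Coprime.gcd_eq_one hme, mul_one]
  · simp only [Finset.mem_filter, Finset.mem_Ioc] at hn
    obtain ⟨⟨hn0, hnN⟩, hsq, hgcd⟩ := hn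
    obtain ⟨m, rfl⟩ : g ∣ n := hgcd ▸ Nat.gcd_dvd_left n (g * e)
    rw [Nat.squarefree_mul_iff] at hsq
    rw [Nat.gcd_mul_left] at hgcd
    refine ⟨m, ?_, rfl⟩
    simp only [Finset.mem_filter, Finset.mem_Ioc, Nat.coprime_mul_iff_right]
    refine ⟨⟨Nat.pos_of_mul_pos_left hn0, ?_⟩, hsq.2.2, hsq.1.symm, ?_⟩
    · rw [Nat.le_div_iff_mul_le hg0, mul_comm]
      exact hnN
    · exact Nat.eq_of_mul_eq_mul_left hg0 (by rw [hgcd, mul_one])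

theorem card_squarefree_eq_sum {d : ℕ} (hd : Squarefree d) (N : ℕ) :
    ((Finset.Ioc 0 N).filter Squarefree).card =
      ∑ g ∈ d.divisors, squarefreeCoprimeCount d (N / g) := by
  rw [Finset.card_eq_sum_card_fiberwise (f := fun n => n.gcd d) (t := d.divisors)
    fun n _ => Nat.mem_divisors.mpr ⟨Nat.gcd_dvd_right n d, hd.ne_zero⟩]
  refine Finset.sum_congr rfl fun g hg => ?_
  rw [Finset.filter_filter, card_squarefree_gcd_eq hd (Nat.dvd_of_mem_divisors hg)]

theorem filter_range_succ_eq_filter_Ioc {p : ℕ → Prop} [DecidablePred p] (h0 : ¬p 0) (N : ℕ) :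
    (Finset.range (N + 1)).filter p = (Finset.Ioc 0 N).filter p := by
  ext n
  rcases Nat.eq_zero_or_pos n with rfl | hn
  · simp [h0]
  · simp [hn]

theorem sum_divisors_one_div_eq {d : ℕ} (hd : d ≠ 0) :
    ∑ g ∈ d.divisors, 1 / (g : ℝ) = (∑ e ∈ d.divisors, (e : ℝ)) / d := by
  rw [← Nat.sum_div_divisors d (fun e => (e : ℝ)), Finset.sum_div]
  refine Finset.sum_congr rfl fun g hg => ?_
  have hd' : (d : ℝ) ≠ 0 := by exact_mod_cast hd
  have hg' : (g : ℝ) ≠ 0 := by exact_mod_cast (Nat.pos_of_mem_divisors hg).ne'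
  rw [Nat.cast_div (Nat.dvd_of_mem_divisors hg) hg']
  field_simp

theorem abs_card_squarefree_dvd_sub_le {d N : ℕ} (hd : Squarefree d) (hN : 0 < N) :
    |(squarefreeCoprimeCount d (N / d) : ℝ) -
      (((Finset.Ioc 0 N).filter Squarefree).card : ℝ) / (∑ e ∈ d.divisors, (e : ℝ))| ≤
      24 * √N := by
  have hd0 : 0 < d := Nat.pos_of_ne_zero hd.ne_zero
  have hdR : (0 : ℝ) < d := by exact_mod_cast hd0
  have hNR : (0 : ℝ) < N := by exact_mod_cast hN
  obtain ⟨c, hc⟩ := exists_abs_squarefreeCoprimeCount_sub_le hd.ne_zero N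
  set τ : ℝ := (d.divisors.card : ℝ)
  set σ : ℝ := ∑ e ∈ d.divisors, (e : ℝ)
  have hdσ : (d : ℝ) ≤ σ :=
    Finset.single_le_sum (f := fun e : ℕ => (e : ℝ)) (fun e _ => e.cast_nonneg)
      (Nat.mem_divisors_self d hd.ne_zero)
  have hσ0 : 0 < σ := hdR.trans_le hdσ
  have hτ0 : 0 ≤ τ := Nat.cast_nonneg _
  have hτd : τ ≤ 2 * √d := by
    have h : (d.divisors.card : ℝ) ≤ 2 * (Nat.sqrt d : ℝ) := by
      exact_mod_cast Nat.card_divisors_le_two_mul_sqrt d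
    exact h.trans (by linarith [Real.nat_sqrt_le_real_sqrt (a := d)])
  have hE : ∀ g ∈ d.divisors,
      |(squarefreeCoprimeCount d (N / g) : ℝ) - c * (N / g)| ≤ 4 * τ * √(N / g) := by
    intro g hg
    have hg0 : (0 : ℝ) < g := by exact_mod_cast Nat.pos_of_mem_divisors hg
    have := hc (N / g) (by positivity) (by rw [Nat.floor_div_eq_div]; exact Nat.div_le_self N g)
    rwa [Nat.floor_div_eq_div] at this
  have hfirst : |(squarefreeCoprimeCount d (N / d) : ℝ) - c * (N / d)| ≤ 8 * √N := by
    refine (hE d (Nat.mem_divisors_self d hd.ne_zero)).trans ?_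
    calc 4 * τ * √(N / d) ≤ 4 * (2 * √d) * √(N / d) := by gcongr
      _ = 8 * √N := by
        have hs : √(d : ℝ) * √((N : ℝ) / d) = √N := by
          rw [← Real.sqrt_mul hdR.le, mul_div_cancel₀ _ hdR.ne']
        linear_combination 8 * hs
  have hsecond : |(((Finset.Ioc 0 N).filter Squarefree).card : ℝ) - c * (N / d) * σ| ≤
      16 * √N * σ := by
    have hmain : c * (N / d) * σ = ∑ g ∈ d.divisors, c * ((N : ℝ) / g) := by
      have : ∑ g ∈ d.divisors, c * ((N : ℝ) / g) = c * N * ∑ g ∈ d.divisors, 1 / (g : ℝ) := by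
        rw [Finset.mul_sum]
        exact Finset.sum_congr rfl fun g _ => by ring
      rw [this, sum_divisors_one_div_eq hd.ne_zero]
      ring
    rw [card_squarefree_eq_sum hd, hmain]
    push_cast
    rw [← Finset.sum_sub_distrib]
    calc _ ≤ ∑ g ∈ d.divisors, 4 * τ * √N := by
          refine (Finset.abs_sum_le_sum_abs _ _).trans (Finset.sum_le_sum fun g hg => ?_)
          refine (hE g hg).trans ?_
          have hg1 : (1 : ℝ) ≤ g := by exact_mod_cast Nat.pos_of_mem_divisors hg
          gcongr
          exact div_le_self hNR.le hg1
      _ = 4 * τ ^ 2 * √N := by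
          rw [Finset.sum_const, nsmul_eq_mul]
          ring
      _ ≤ 4 * (2 * √d) ^ 2 * √N := by gcongr
      _ = 16 * √N * d := by
          rw [mul_pow, Real.sq_sqrt hdR.le]
          ring
      _ ≤ 16 * √N * σ := by gcongr
  have hquot : |c * (N / d) - (((Finset.Ioc 0 N).filter Squarefree).card : ℝ) / σ| ≤
      16 * √N := by
    rw [abs_sub_comm, div_sub' hσ0.ne', abs_div, abs_of_pos hσ0, div_le_iff₀ hσ0, mul_comm σ]
    exact hsecond
  calc _ ≤ _ := abs_sub_le _ (c * ((N : ℝ) / d)) _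
    _ ≤ 8 * √N + 16 * √N := add_le_add hfirst hquot
    _ = 24 * √N := by ring

/-- error bound for squarefree numbers divisible by a squarefree d. -/
theorem squarefree_divisible_count_error :
    ∃ C : ℝ, ∀ X : ℝ, 1 ≤ X → ∀ d : ℕ, Squarefree d → (d : ℝ) ≤ X →
      |(((Finset.range (⌊X⌋₊ + 1)).filter (fun n => Squarefree n ∧ d ∣ n)).card : ℝ) -
        (((Finset.range (⌊X⌋₊ + 1)).filter (fun n => Squarefree n)).card : ℝ) /
          (∑ e ∈ d.divisors, (e : ℝ))|
        ≤ C * X ^ ((3 : ℝ) / 4) := by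
  refine ⟨24, fun X hX d hd _ => ?_⟩
  rw [filter_range_succ_eq_filter_Ioc (by simp), filter_range_succ_eq_filter_Ioc (by simp)]
  have hdvd : ((Finset.Ioc 0 ⌊X⌋₊).filter (fun n => Squarefree n ∧ d ∣ n)).card =
      squarefreeCoprimeCount d (⌊X⌋₊ / d) := by
    rw [← card_squarefree_gcd_eq hd dvd_rfl]
    simp only [Nat.gcd_eq_right_iff_dvd]
  rw [hdvd]
  refine (abs_card_squarefree_dvd_sub_le hd (Nat.floor_pos.mpr hX)).trans ?_
  have hfloor : √(⌊X⌋₊ : ℝ) ≤ √X := Real.sqrt_le_sqrt (Nat.floor_le (by linarith))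
  have hpow : √X ≤ X ^ ((3 : ℝ) / 4) := by
    rw [Real.sqrt_eq_rpow]
    exact Real.rpow_le_rpow_of_exponent_le hX (by norm_num)
  linarith
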